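/- arXiv:2511.01578 — 4 statements merged into one kernel-verified Lean document; each statement's English description precedes it below -/
import Mathlib

section
/- Let (Ω, ν) be a measure space with 0 < ν(Ω) < ∞, let 0 < r < p be reals, C_r, C_p > 0, t₀ ≥ 0, and let w : Ω → ℝ be measurable with ∫_Ω |w|^{(p+1)/p} dν < ∞. Set α = p(r+1)/(r(p+1)) (so α > 1) and T = (∫_Ω |w|^{(p+1)/p} dν)^{p/(p+1)}. If T ≤ (C_p/C_r)^{pr/(p-r)} · ν(Ω)^{p/(p+1)}, then C_r ∫_{{|w| ≤ t₀}} |w|^{(r+1)/r} dν + C_p ∫_{{|w| > t₀}} |w|^{(p+1)/p} dν ≥ 2^{1-α} · ν(Ω)^{1-α} · C_r · T^{(r+1)/r}. -/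
open MeasureTheory

/-- Hölder's inequality against the constant function `1` on a finite measure space. -/
theorem integral_rpow_le_measure_rpow_mul_integral_rpow {X : Type*} [MeasurableSpace X]
    (μ : Measure X) [IsFiniteMeasure μ] {a : ℝ} (ha : 1 < a) {f : X → ℝ}
    (hf0 : ∀ x, 0 ≤ f x) (hf : MemLp f (ENNReal.ofReal a) μ) :
    (∫ x, f x ∂μ) ^ a ≤ μ.real Set.univ ^ (a - 1) * ∫ x, f x ^ a ∂μ := by
  have hconj := Real.HolderConjugate.conjExponent ha
  have h := integral_mul_le_Lp_mul_Lq_of_nonneg hconj (μ := μ) (f := f) (g := fun _ => (1 : ℝ))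
    (.of_forall hf0) (.of_forall fun _ => zero_le_one) hf (memLp_const 1)
  simp only [mul_one, Real.one_rpow, integral_const, smul_eq_mul] at h
  have ha0 : a ≠ 0 := by positivity
  have hJ : 0 ≤ ∫ x, f x ^ a ∂μ := integral_nonneg fun x => Real.rpow_nonneg (hf0 x) a
  have hexp : 1 / a.conjExponent * a = a - 1 := by
    have : a - 1 ≠ 0 := by linarith
    rw [Real.conjExponent]
    field_simp
  calc (∫ x, f x ∂μ) ^ a
      ≤ ((∫ x, f x ^ a ∂μ) ^ (1 / a) * μ.real Set.univ ^ (1 / a.conjExponent)) ^ a :=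
        Real.rpow_le_rpow (integral_nonneg hf0) h (by positivity)
    _ = μ.real Set.univ ^ (a - 1) * ∫ x, f x ^ a ∂μ := by
        rw [Real.mul_rpow (by positivity) (by positivity), ← Real.rpow_mul hJ,
          ← Real.rpow_mul measureReal_nonneg, hexp, one_div_mul_cancel ha0, Real.rpow_one,
          mul_comm]

/-- The convexity inequality `2 ^ (1 - c) * (a + b) ^ c ≤ a ^ c + b ^ c` for `1 ≤ c`. -/
theorem two_rpow_mul_add_rpow_le {a b c : ℝ} (ha : 0 ≤ a) (hb : 0 ≤ b) (hc : 1 ≤ c) :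
    (2 : ℝ) ^ (1 - c) * (a + b) ^ c ≤ a ^ c + b ^ c := by
  have h : (a + b) ^ c ≤ (2 : ℝ) ^ (c - 1) * (a ^ c + b ^ c) := by
    lift a to NNReal using ha
    lift b to NNReal using hb
    exact_mod_cast NNReal.rpow_add_le_mul_rpow_add_rpow a b hc
  calc (2 : ℝ) ^ (1 - c) * (a + b) ^ c
      ≤ (2 : ℝ) ^ (1 - c) * ((2 : ℝ) ^ (c - 1) * (a ^ c + b ^ c)) := by gcongr
    _ = a ^ c + b ^ c := by
        rw [← mul_assoc, ← Real.rpow_add two_pos, sub_add_sub_cancel, sub_self, Real.rpow_zero,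
          one_mul]

/-- Case 1 of Lemma 2.1: the two-piece lower bound via Hölder's
inequality and the convexity inequality `aᵅ + bᵅ ≥ 2^{1-α}(a+b)ᵅ`. -/
theorem two_piece_lower_bound {Ω : Type*} [MeasurableSpace Ω]
    (ν : Measure Ω) (hν0 : 0 < ν Set.univ) (hνfin : ν Set.univ < ⊤)
    (r p Cr Cp t₀ : ℝ) (hr : 0 < r) (hrp : r < p)
    (hCr : 0 < Cr) (hCp : 0 < Cp) (ht₀ : 0 ≤ t₀)
    (w : Ω → ℝ) (hw : Measurable w)
    (hint : Integrable (fun x => |w x| ^ ((p + 1) / p)) ν)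
    (α T : ℝ)
    (hα : α = p * (r + 1) / (r * (p + 1)))
    (hT : T = (∫ x, |w x| ^ ((p + 1) / p) ∂ν) ^ (p / (p + 1)))
    (hTle : T ≤ (Cp / Cr) ^ (p * r / (p - r)) * (ν Set.univ).toReal ^ (p / (p + 1))) :
    (2:ℝ) ^ (1 - α) * (ν Set.univ).toReal ^ (1 - α) * Cr * T ^ ((r + 1) / r)
      ≤ Cr * (∫ x in {x | |w x| ≤ t₀}, |w x| ^ ((r + 1) / r) ∂ν)
        + Cp * (∫ x in {x | t₀ < |w x|}, |w x| ^ ((p + 1) / p) ∂ν) := by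
  have : IsFiniteMeasure ν := ⟨hνfin⟩
  have hp : 0 < p := hr.trans hrp
  have hpr : 0 < p - r := sub_pos.2 hrp
  have hα_sub : α - 1 = (p - r) / (r * (p + 1)) := by
    rw [hα]
    field_simp
    ring
  have hα1 : 1 < α := by
    have : 0 < (p - r) / (r * (p + 1)) := by positivity
    linarith
  have hqα : (p + 1) / p * α = (r + 1) / r := by
    rw [hα]
    field_simp
  change (2 : ℝ) ^ (1 - α) * ν.real Set.univ ^ (1 - α) * Cr * T ^ ((r + 1) / r) ≤ _
  change T ≤ _ * ν.real Set.univ ^ (p / (p + 1)) at hTle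
  have hV : 0 < ν.real Set.univ := ENNReal.toReal_pos hν0.ne' hνfin.ne
  set V := ν.real Set.univ
  set f : Ω → ℝ := fun x => |w x| ^ ((p + 1) / p) with hf
  have hf0 : ∀ x, 0 ≤ f x := fun x => Real.rpow_nonneg (abs_nonneg _) _
  have hfα : ∀ x, f x ^ α = |w x| ^ ((r + 1) / r) := fun x => by
    rw [hf, ← hqα, ← Real.rpow_mul (abs_nonneg _)]
  set S : Set Ω := {x | |w x| ≤ t₀} with hSdef
  have hS : MeasurableSet S := measurableSet_le hw.abs measurable_const
  have hSc : {x | t₀ < |w x|} = Sᶜ := by ext; simp [hSdef]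
  rw [hSc]
  set A := ∫ x in S, f x ∂ν
  set B := ∫ x in Sᶜ, f x ∂ν
  set J := ∫ x in S, |w x| ^ ((r + 1) / r) ∂ν
  have hA0 : 0 ≤ A := integral_nonneg hf0
  have hB0 : 0 ≤ B := integral_nonneg hf0
  have hJ0 : 0 ≤ J := integral_nonneg fun x => Real.rpow_nonneg (abs_nonneg _) _
  rw [← integral_add_compl hS hint] at hT
  change T = (A + B) ^ (p / (p + 1)) at hT
  have hTα : T ^ ((r + 1) / r) = (A + B) ^ α := by
    rw [hT, ← Real.rpow_mul (by positivity), ← hqα]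
    congr 1
    field_simp
  have hsmall : V ^ (1 - α) * A ^ α ≤ J := by
    have hmem : MemLp f (ENNReal.ofReal α) (ν.restrict S) := by
      refine MemLp.of_bound hint.aestronglyMeasurable.restrict (t₀ ^ ((p + 1) / p)) ?_
      filter_upwards [ae_restrict_mem hS] with x hx
      rw [Real.norm_of_nonneg (hf0 x)]
      exact Real.rpow_le_rpow (abs_nonneg _) hx (by positivity)
    have h := integral_rpow_le_measure_rpow_mul_integral_rpow (ν.restrict S) hα1 hf0 hmem
    simp only [hfα] at h
    have hVS : (ν.restrict S).real Set.univ ≤ V := by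
      rw [measureReal_restrict_apply_univ]
      exact measureReal_mono (Set.subset_univ S)
    calc V ^ (1 - α) * A ^ α
        ≤ V ^ (1 - α) * ((ν.restrict S).real Set.univ ^ (α - 1) * J) := by gcongr
      _ ≤ V ^ (1 - α) * (V ^ (α - 1) * J) := by gcongr
      _ = J := by
          rw [← mul_assoc, ← Real.rpow_add hV, sub_add_sub_cancel, sub_self, Real.rpow_zero,
            one_mul]
  have hlarge : Cr * (V ^ (1 - α) * B ^ α) ≤ Cp * B := by
    have hBpow : B ^ (α - 1) ≤ Cp / Cr * V ^ (α - 1) := by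
      have hT' : T ^ ((p + 1) / p * (α - 1)) = (A + B) ^ (α - 1) := by
        rw [hT, ← Real.rpow_mul (by positivity)]
        congr 1
        field_simp
      calc B ^ (α - 1) ≤ (A + B) ^ (α - 1) := by
            gcongr
            linarith
        _ = T ^ ((p + 1) / p * (α - 1)) := hT'.symm
        _ ≤ ((Cp / Cr) ^ (p * r / (p - r)) * V ^ (p / (p + 1))) ^ ((p + 1) / p * (α - 1)) := by
            have : 0 ≤ α - 1 := by linarith
            exact Real.rpow_le_rpow (hT ▸ by positivity) hTle (by positivity)
        _ = Cp / Cr * V ^ (α - 1) := by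
            rw [Real.mul_rpow (by positivity) (by positivity), ← Real.rpow_mul (by positivity),
              ← Real.rpow_mul hV.le]
            have h1 : p * r / (p - r) * ((p + 1) / p * (α - 1)) = 1 := by
              rw [hα_sub]
              field_simp
            have h2 : p / (p + 1) * ((p + 1) / p * (α - 1)) = α - 1 := by field_simp
            rw [h1, h2, Real.rpow_one]
    have hBα : B ^ α = B ^ (α - 1) * B := by
      conv_lhs => rw [← sub_add_cancel α 1]
      rw [Real.rpow_add_one' hB0 (by linarith)]
    calc Cr * (V ^ (1 - α) * B ^ α)
        ≤ Cr * (V ^ (1 - α) * (Cp / Cr * V ^ (α - 1) * B)) := by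
          rw [hBα]
          gcongr
      _ = Cr * (Cp / Cr) * (V ^ (1 - α) * V ^ (α - 1)) * B := by ring
      _ = Cp * B := by
          rw [← Real.rpow_add hV, sub_add_sub_cancel, sub_self, Real.rpow_zero, mul_one,
            mul_div_cancel₀ _ hCr.ne']
  calc (2 : ℝ) ^ (1 - α) * V ^ (1 - α) * Cr * T ^ ((r + 1) / r)
      = Cr * V ^ (1 - α) * ((2 : ℝ) ^ (1 - α) * (A + B) ^ α) := by
        rw [hTα]
        ring
    _ ≤ Cr * V ^ (1 - α) * (A ^ α + B ^ α) := by
        gcongr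
        exact two_rpow_mul_add_rpow_le hA0 hB0 hα1.le
    _ = Cr * (V ^ (1 - α) * A ^ α) + Cr * (V ^ (1 - α) * B ^ α) := by ring
    _ ≤ Cr * J + Cp * B := by gcongr
end

section
/- Let (Ω, ν) be a measure space with ν(Ω) < ∞, let 0 < r < p be reals, c_r, c_p > 0, t₀ ≥ 0, and let g : ℝ → ℝ satisfy t·g(t) ≥ c_r·|t|^{(r+1)/r} for all |t| ≤ t₀ and t·g(t) ≥ c_p·|t|^{(p+1)/p} for all |t| > t₀. Let (wₙ) be a sequence of measurable functions on Ω such that each ∫_Ω g(wₙ)·wₙ dν is finite and ∫_Ω g(wₙ)·wₙ dν → 0. Then ∫_Ω |wₙ|^{(p+1)/p} dν → 0. -/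
open MeasureTheory Filter

/-- A two-regime lower bound `c * |t| ^ b ≤ f t` (near zero) and `c' * |t| ^ a ≤ f t` (away from
zero), with `0 ≤ a ≤ b`, controls `|t| ^ a` by a multiple of `f t` up to an additive error. -/
theorem abs_rpow_le_add_mul {f : ℝ → ℝ} {a b c c' t₀ δ : ℝ} (ha : 0 ≤ a) (hab : a ≤ b)
    (hc : 0 < c) (hc' : 0 < c') (hδ : 0 < δ)
    (hf : ∀ t, |t| ≤ t₀ → c * |t| ^ b ≤ f t) (hf' : ∀ t, t₀ < |t| → c' * |t| ^ a ≤ f t) (t : ℝ) :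
    |t| ^ a ≤ δ ^ a + (1 / c' + 1 / (c * δ ^ (b - a))) * f t := by
  have hδa : 0 < δ ^ a := Real.rpow_pos_of_pos hδ a
  have hk : 0 < c * δ ^ (b - a) := mul_pos hc (Real.rpow_pos_of_pos hδ _)
  rcases le_or_gt |t| t₀ with h | h
  · have h1 := hf t h
    have h0 : 0 ≤ f t := le_trans (by positivity) h1
    rcases le_or_gt |t| δ with hs | hs
    · have := Real.rpow_le_rpow (abs_nonneg t) hs ha
      have : 0 ≤ (1 / c' + 1 / (c * δ ^ (b - a))) * f t := by positivity
      linarith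
    · have hsplit : |t| ^ b = |t| ^ (b - a) * |t| ^ a := by
        rw [← Real.rpow_add (hδ.trans hs), sub_add_cancel]
      have hle : c * δ ^ (b - a) * |t| ^ a ≤ f t := by
        refine le_trans ?_ h1
        rw [hsplit, mul_assoc]
        have := Real.rpow_le_rpow hδ.le hs.le (sub_nonneg.2 hab)
        gcongr
      have h2 : |t| ^ a ≤ 1 / (c * δ ^ (b - a)) * f t := by
        rw [one_div_mul_eq_div, le_div_iff₀ hk]
        linarith
      have : 0 ≤ 1 / c' * f t := by positivity
      linarith [add_mul (1 / c') (1 / (c * δ ^ (b - a))) (f t)]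
  · have h1 := hf' t h
    have h0 : 0 ≤ f t := le_trans (by positivity) h1
    have h2 : |t| ^ a ≤ 1 / c' * f t := by
      rw [one_div_mul_eq_div, le_div_iff₀ hc']
      linarith
    have : 0 ≤ 1 / (c * δ ^ (b - a)) * f t := by positivity
    linarith [add_mul (1 / c') (1 / (c * δ ^ (b - a))) (f t)]

/-- On a finite measure space, if nonnegative functions `u n` satisfy `u n ≤ ε + C ε * v n` for
every `ε > 0` and `∫ v n → 0`, then `∫ u n → 0`. -/
theorem tendsto_integral_zero_of_le_add_mul {Ω : Type*} [MeasurableSpace Ω] {ν : Measure Ω}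
    [IsFiniteMeasure ν] {u v : ℕ → Ω → ℝ} (hu : ∀ n x, 0 ≤ u n x)
    (hv : ∀ n, Integrable (v n) ν)
    (huv : ∀ ε > 0, ∃ C : ℝ, ∀ n x, u n x ≤ ε + C * v n x)
    (hlim : Tendsto (fun n => ∫ x, v n x ∂ν) atTop (nhds 0)) :
    Tendsto (fun n => ∫ x, u n x ∂ν) atTop (nhds 0) := by
  refine tendsto_order.2 ⟨fun a ha => .of_forall fun n =>
    ha.trans_le (integral_nonneg (hu n)), fun η hη => ?_⟩
  have hm : 0 < ν.real Set.univ + 1 := by positivity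
  obtain ⟨C, hC⟩ := huv (η / (ν.real Set.univ + 1)) (by positivity)
  have hbound : ∀ n, ∫ x, u n x ∂ν ≤
      η / (ν.real Set.univ + 1) * ν.real Set.univ + C * ∫ x, v n x ∂ν := fun n => by
    calc ∫ x, u n x ∂ν ≤ ∫ x, (η / (ν.real Set.univ + 1) + C * v n x) ∂ν :=
          integral_mono_of_nonneg (.of_forall (hu n))
            ((integrable_const _).add ((hv n).const_mul C)) (.of_forall (hC n))
      _ = _ := by
          rw [integral_add (integrable_const _) ((hv n).const_mul C), integral_const,
            integral_const_mul, smul_eq_mul, mul_comm (ν.real Set.univ)]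
  have hlt : η / (ν.real Set.univ + 1) * ν.real Set.univ + C * 0 < η := by
    rw [mul_zero, add_zero, div_mul_eq_mul_div, div_lt_iff₀ hm]
    nlinarith
  filter_upwards [((hlim.const_mul C).const_add _).eventually_lt_const hlt] with n hn
  exact (hbound n).trans_lt hn

/-- If `t·g(t)` dominates `c_r|t|^{(r+1)/r}` for `|t| ≤ t₀` and
`c_p|t|^{(p+1)/p}` for `|t| > t₀` on a finite measure space, and
`∫ g(wₙ)·wₙ dν → 0`, then `∫ |wₙ|^{(p+1)/p} dν → 0`. -/
theorem norm_vanishing {Ω : Type*} [MeasurableSpace Ω]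
    (ν : Measure Ω) (hν : ν Set.univ < ⊤)
    (r p cr cp t₀ : ℝ) (hr : 0 < r) (hrp : r < p)
    (hcr : 0 < cr) (hcp : 0 < cp) (ht₀ : 0 ≤ t₀)
    (g : ℝ → ℝ)
    (hg1 : ∀ t : ℝ, |t| ≤ t₀ → cr * |t| ^ ((r + 1) / r) ≤ t * g t)
    (hg2 : ∀ t : ℝ, t₀ < |t| → cp * |t| ^ ((p + 1) / p) ≤ t * g t)
    (w : ℕ → Ω → ℝ) (hw : ∀ n, Measurable (w n))
    (hint : ∀ n, Integrable (fun x => g (w n x) * w n x) ν)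
    (hlim : Tendsto (fun n => ∫ x, g (w n x) * w n x ∂ν) atTop (nhds 0)) :
    Tendsto (fun n => ∫ x, |w n x| ^ ((p + 1) / p) ∂ν) atTop (nhds 0) := by
  have : IsFiniteMeasure ν := ⟨hν⟩
  have hp : 0 < p := hr.trans hrp
  have ha : 0 < (p + 1) / p := by positivity
  have hab : (p + 1) / p ≤ (r + 1) / r := by
    rw [div_le_div_iff₀ hp hr]
    linarith
  refine tendsto_integral_zero_of_le_add_mul (fun n x => by positivity) hint
    (fun ε hε => ?_) hlim
  have key := abs_rpow_le_add_mul (f := fun t => g t * t) ha.le hab hcr hcp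
    (Real.rpow_pos_of_pos hε ((p + 1) / p)⁻¹) (fun t h => (hg1 t h).trans_eq (mul_comm _ _))
    (fun t h => (hg2 t h).trans_eq (mul_comm _ _))
  rw [Real.rpow_inv_rpow hε.le ha.ne'] at key
  exact ⟨_, fun n x => key (w n x)⟩
end

section
/- Let (Ω, ν) be a measure space with ν(Ω) < ∞, let p > 0, and let g : ℝ → ℝ be continuous with |g(t)| ≤ |t|^{1/p} for all t. Let (wₙ) be measurable functions with wₙ → w ν-almost everywhere and sup_n ∫_Ω |wₙ|^{(p+1)/p} dν < ∞. Then for every measurable φ : Ω → ℝ with ∫_Ω |φ|^{(p+1)/p} dν < ∞, one has ∫_Ω g(wₙ)·φ dν → ∫_Ω g(w)·φ dν. -/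
open MeasureTheory Filter

open scoped ENNReal

/-- If `f` is bounded in `L^p` and `φ ∈ L^q` with `p`, `q` conjugate and `q < ∞`, then the products
`f n * φ` have uniformly absolutely continuous integrals. -/
theorem unifIntegrable_mul_of_eLpNorm_le {α ι : Type*} [MeasurableSpace α] {μ : Measure α}
    {p q : ℝ≥0∞} [p.HolderConjugate q] (hq : q ≠ ∞) {f : ι → α → ℝ} {φ : α → ℝ} {C : ℝ≥0∞}
    (hC : C ≠ ∞) (hf : ∀ n, AEStronglyMeasurable (f n) μ) (hfC : ∀ n, eLpNorm (f n) p μ ≤ C)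
    (hφ : MemLp φ q μ) :
    UnifIntegrable (fun n => f n * φ) 1 μ := by
  have : q.HolderConjugate p := ENNReal.HolderConjugate.symm
  intro ε hε
  have hC1 : 0 < C.toReal + 1 := by positivity
  obtain ⟨δ, hδ, h⟩ := hφ.eLpNorm_indicator_le (ENNReal.HolderConjugate.one_le q p) hq
    (div_pos hε hC1)
  refine ⟨δ, hδ, fun n s hs hμs => ?_⟩
  have hCle : C ≤ ENNReal.ofReal (C.toReal + 1) := by
    rw [ENNReal.le_ofReal_iff_toReal_le hC hC1.le]
    linarith
  calc eLpNorm (s.indicator (f n * φ)) 1 μ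
      = eLpNorm (f n • s.indicator φ) 1 μ := by
        congr 1
        ext x
        by_cases hx : x ∈ s <;> simp [hx]
    _ ≤ eLpNorm (f n) p μ * eLpNorm (s.indicator φ) q μ :=
        eLpNorm_smul_le_mul_eLpNorm (hφ.1.indicator hs) (hf n)
    _ ≤ ENNReal.ofReal (C.toReal + 1) * ENNReal.ofReal (ε / (C.toReal + 1)) :=
        mul_le_mul' ((hfC n).trans hCle) (h s hs hμs)
    _ = ENNReal.ofReal ε := by
        rw [← ENNReal.ofReal_mul hC1.le, mul_div_cancel₀ _ (by positivity)]

/-- On a finite measure space, an a.e. convergent sequence that is bounded in `L^p` converges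
when paired with any function in `L^q`, where `p`, `q` are conjugate and `q < ∞`. -/
theorem tendsto_integral_mul_of_ae_tendsto_of_eLpNorm_le {α : Type*} [MeasurableSpace α]
    {μ : Measure α} [IsFiniteMeasure μ] {p q : ℝ≥0∞} [p.HolderConjugate q] (hq : q ≠ ∞)
    {f : ℕ → α → ℝ} {g φ : α → ℝ} {C : ℝ≥0∞} (hC : C ≠ ∞)
    (hf : ∀ n, AEStronglyMeasurable (f n) μ) (hfC : ∀ n, eLpNorm (f n) p μ ≤ C)
    (hfg : ∀ᵐ x ∂μ, Tendsto (fun n => f n x) atTop (nhds (g x))) (hφ : MemLp φ q μ) :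
    Tendsto (fun n => ∫ x, f n x * φ x ∂μ) atTop (nhds (∫ x, g x * φ x ∂μ)) := by
  have hfmem (n : ℕ) : MemLp (f n) p μ := ⟨hf n, (hfC n).trans_lt hC.lt_top⟩
  have hgmem : MemLp g p μ :=
    ⟨aestronglyMeasurable_of_tendsto_ae atTop hf hfg,
      (Lp.eLpNorm_le_of_ae_tendsto (.of_forall hfC) hf hfg).trans_lt hC.lt_top⟩
  have hgφ : MemLp (g * φ) 1 μ := hφ.mul hgmem
  have hfφ (n : ℕ) : MemLp (f n * φ) 1 μ := hφ.mul (hfmem n)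
  refine tendsto_integral_of_L1' (F := fun n => f n * φ) (g * φ) hgφ.1
    (.of_forall fun n => memLp_one_iff_integrable.1 (hfφ n)) ?_
  refine tendsto_Lp_finite_of_tendsto_ae le_rfl ENNReal.one_ne_top (fun n => (hfφ n).1) hgφ
    (unifIntegrable_mul_of_eLpNorm_le hq hC hf hfC hφ) ?_
  filter_upwards [hfg] with x hx
  exact hx.mul_const _

/-- weak-type convergence of `g(wₙ)` against `L^{(p+1)/p}` test
functions, from a.e. convergence, the growth bound `|g(t)| ≤ |t|^{1/p}` and a
uniform `L^{(p+1)/p}` bound on `(wₙ)`, on a finite measure space. -/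
theorem weak_convergence_pairing {Ω : Type*} [MeasurableSpace Ω]
    (ν : Measure Ω) (hν : ν Set.univ < ⊤)
    (p : ℝ) (hp : 0 < p) (g : ℝ → ℝ) (hgc : Continuous g)
    (hg : ∀ t : ℝ, |g t| ≤ |t| ^ (1 / p))
    (w : ℕ → Ω → ℝ) (hw : ∀ n, Measurable (w n)) (wlim : Ω → ℝ)
    (hae : ∀ᵐ x ∂ν, Tendsto (fun n => w n x) atTop (nhds (wlim x)))
    (hbdd : ∃ C : ENNReal, C < ⊤ ∧
      ∀ n, (∫⁻ x, ENNReal.ofReal (|w n x| ^ ((p + 1) / p)) ∂ν) ≤ C) :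
    ∀ φ : Ω → ℝ, Measurable φ →
      Integrable (fun x => |φ x| ^ ((p + 1) / p)) ν →
      Tendsto (fun n => ∫ x, g (w n x) * φ x ∂ν) atTop
        (nhds (∫ x, g (wlim x) * φ x ∂ν)) := by
  intro φ hφm hφ
  have : IsFiniteMeasure ν := ⟨hν⟩
  obtain ⟨C, hC, hCw⟩ := hbdd
  have hp1 : 0 < p + 1 := by linarith
  have hq : 0 < (p + 1) / p := by positivity
  have hpq : (p + 1).HolderConjugate ((p + 1) / p) := by
    rw [Real.holderConjugate_iff]
    refine ⟨by linarith, ?_⟩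
    field_simp
    ring
  have : (ENNReal.ofReal (p + 1)).HolderConjugate (ENNReal.ofReal ((p + 1) / p)) :=
    hpq.ennrealOfReal
  have hgrowth (t : ℝ) : ‖g t‖ₑ ^ (p + 1) ≤ ENNReal.ofReal (|t| ^ ((p + 1) / p)) := by
    rw [Real.enorm_eq_ofReal_abs, ENNReal.ofReal_rpow_of_nonneg (abs_nonneg _) hp1.le]
    refine ENNReal.ofReal_le_ofReal ?_
    calc |g t| ^ (p + 1) ≤ (|t| ^ (1 / p)) ^ (p + 1) :=
          Real.rpow_le_rpow (abs_nonneg _) (hg t) hp1.le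
      _ = |t| ^ ((p + 1) / p) := by
          rw [← Real.rpow_mul (abs_nonneg _), one_div_mul_eq_div]
  refine tendsto_integral_mul_of_ae_tendsto_of_eLpNorm_le (p := ENNReal.ofReal (p + 1))
    (q := ENNReal.ofReal ((p + 1) / p)) ENNReal.ofReal_ne_top (f := fun n x => g (w n x))
    (C := C ^ (1 / (p + 1))) (ENNReal.rpow_ne_top_of_nonneg (by positivity) hC.ne)
    (fun n => (hgc.measurable.comp (hw n)).aestronglyMeasurable) (fun n => ?_) ?_ ?_
  · rw [eLpNorm_eq_lintegral_rpow_enorm_toReal (by simpa using hp1) ENNReal.ofReal_ne_top,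
      ENNReal.toReal_ofReal hp1.le]
    exact ENNReal.rpow_le_rpow ((lintegral_mono fun x => hgrowth (w n x)).trans (hCw n))
      (by positivity)
  · filter_upwards [hae] with x hx
    exact (hgc.tendsto _).comp hx
  · rw [← integrable_norm_rpow_iff hφm.aestronglyMeasurable (by simpa using hq)
      ENNReal.ofReal_ne_top, ENNReal.toReal_ofReal hq.le]
    exact hφ
end

section
/- Let C₁, C₂, C₃ > 0 and real exponents 0 < β < α < γ. Then there exists μ₀ > 0 such that for every μ ∈ (0, μ₀), the function h(t) = C₁·t^α - C₂·μ·t^β - C₃·t^γ admits real numbers 0 < R₀ < R₁ with: h(t) < 0 for all t ∈ (0, R₀), h(R₀) = 0, h(t) > 0 for all t ∈ (R₀, R₁), h(R₁) = 0, and h(t) < 0 for all t > R₁. In particular, the maximum of h on (0,∞) is positive. -/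
/-- A strictly concave function with two zeros `a < b` is positive between them, and negative
to the left of `a` and to the right of `b`. -/
theorem StrictConcaveOn.sign_of_two_zeros {s : Set ℝ} {f : ℝ → ℝ} (hf : StrictConcaveOn ℝ s f)
    {a b : ℝ} (ha : a ∈ s) (hb : b ∈ s) (hab : a < b) (hfa : f a = 0) (hfb : f b = 0) :
    (∀ x ∈ s, x < a → f x < 0) ∧ (∀ x, a < x → x < b → 0 < f x) ∧
      (∀ x ∈ s, b < x → f x < 0) := by
  refine ⟨fun x hx hxa => ?_, fun x hax hxb => ?_, fun x hx hbx => ?_⟩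
  · have h := hf.slope_anti_adjacent hx hb hxa hab
    rw [hfa, hfb, sub_self, zero_div, zero_sub, div_pos_iff_of_pos_right (sub_pos.2 hxa)] at h
    linarith
  · have h := hf.lt_on_openSegment ha hb hab.ne
      (by rw [openSegment_eq_Ioo hab]; exact ⟨hax, hxb⟩)
    simpa [hfa, hfb] using h
  · have h := hf.slope_anti_adjacent ha hx hab hbx
    rw [hfa, hfb, sub_self, zero_div, sub_zero, div_lt_iff₀ (sub_pos.2 hbx), zero_mul] at h
    exact h

/-- For `p > 1` and `A, B > 0`, the function `s ↦ A * s - B * s ^ p` is strictly concave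
on `[0, ∞)`. -/
theorem strictConcaveOn_mul_sub_mul_rpow (A : ℝ) {B p : ℝ} (hB : 0 < B) (hp : 1 < p) :
    StrictConcaveOn ℝ (Set.Ici 0) fun s : ℝ => A * s - B * s ^ p := by
  refine ⟨convex_Ici 0, fun x hx y hy hxy u v hu hv huv => ?_⟩
  have h := mul_lt_mul_of_pos_left ((strictConvexOn_rpow hp).2 hx hy hxy hu hv huv) hB
  simp only [smul_eq_mul] at h ⊢
  linarith

/-- For small `c > 0`, the function `s ↦ A * s - B * s ^ p - c` with `p > 1` has exactly two
zeros on `[0, ∞)`, is positive between them and negative elsewhere. -/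
theorem exists_two_zeros_mul_sub_mul_rpow {A B p : ℝ} (hA : 0 < A) (hB : 0 < B) (hp : 1 < p) :
    ∃ m : ℝ, 0 < m ∧ ∀ c : ℝ, 0 < c → c < m → ∃ a b : ℝ, 0 < a ∧ a < b ∧
      A * a - B * a ^ p - c = 0 ∧ A * b - B * b ^ p - c = 0 ∧
      (∀ s, 0 ≤ s → s < a → A * s - B * s ^ p - c < 0) ∧
      (∀ s, a < s → s < b → 0 < A * s - B * s ^ p - c) ∧
      (∀ s, b < s → A * s - B * s ^ p - c < 0) := by
  set G : ℝ → ℝ := fun s => A * s - B * s ^ p with hG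
  have hconc : StrictConcaveOn ℝ (Set.Ici 0) G := strictConcaveOn_mul_sub_mul_rpow A hB hp
  have hcont : Continuous G := by
    have := Real.continuous_rpow_const (q := p) (by linarith)
    fun_prop
  have hG0 : G 0 = 0 := by simp [hG, Real.zero_rpow (by linarith : p ≠ 0)]
  obtain ⟨S, hS, hGS⟩ : ∃ S : ℝ, 0 < S ∧ G S = 0 := by
    refine ⟨(A / B) ^ (p - 1)⁻¹, by positivity, ?_⟩
    have hS : 0 < (A / B) ^ (p - 1)⁻¹ := by positivity
    have h : ((A / B) ^ (p - 1)⁻¹) ^ (p - 1) = A / B :=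
      Real.rpow_inv_rpow (by positivity) (by linarith)
    rw [Real.rpow_sub_one hS.ne', div_eq_div_iff hS.ne' hB.ne'] at h
    simp only [hG]
    linarith
  have hmid : 0 < G (S / 2) :=
    (hconc.sign_of_two_zeros (by simp) hS.le hS hG0 hGS).2.1 _ (by linarith) (by linarith)
  refine ⟨G (S / 2), hmid, fun c hc hcm => ?_⟩
  obtain ⟨a, ⟨ha0, ha⟩, hGa⟩ := intermediate_value_Ioo (by linarith : (0 : ℝ) ≤ S / 2)
    hcont.continuousOn ⟨by rwa [hG0], hcm⟩
  obtain ⟨b, ⟨hb, -⟩, hGb⟩ := intermediate_value_Ioo' (by linarith : S / 2 ≤ S)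
    hcont.continuousOn ⟨by rwa [hGS], hcm⟩
  have hab : a < b := ha.trans hb
  obtain ⟨h₁, h₂, h₃⟩ := (hconc.add_const (-c)).sign_of_two_zeros (a := a) (b := b)
    ha0.le (ha0.trans hab).le hab (by simp [hGa]) (by simp [hGb])
  exact ⟨a, b, ha0, hab, sub_eq_zero.2 hGa, sub_eq_zero.2 hGb, fun s hs hsa => h₁ s hs hsa, h₂,
    fun s hbs => h₃ s ((ha0.trans hab).trans hbs).le hbs⟩

/-- For `C₁, C₂, C₃ > 0` and `0 < β < α < γ`, there exists
`μ₀ > 0` such that for every `μ ∈ (0, μ₀)` the function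
`h(t) = C₁·t^α - C₂·μ·t^β - C₃·t^γ` has first and second positive roots
`R₀ < R₁`, is negative on `(0,R₀)`, positive on `(R₀,R₁)`, negative on
`(R₁,∞)`; in particular its maximum on `(0,∞)` is positive. -/
theorem truncation_roots (C₁ C₂ C₃ α β γ : ℝ)
    (hC₁ : 0 < C₁) (hC₂ : 0 < C₂) (hC₃ : 0 < C₃)
    (hβ : 0 < β) (hβα : β < α) (hαγ : α < γ) :
    ∃ μ₀ : ℝ, 0 < μ₀ ∧ ∀ μ : ℝ, 0 < μ → μ < μ₀ →
      ∃ R₀ R₁ : ℝ, 0 < R₀ ∧ R₀ < R₁ ∧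
        (∀ t : ℝ, 0 < t → t < R₀ → C₁ * t ^ α - C₂ * μ * t ^ β - C₃ * t ^ γ < 0) ∧
        C₁ * R₀ ^ α - C₂ * μ * R₀ ^ β - C₃ * R₀ ^ γ = 0 ∧
        (∀ t : ℝ, R₀ < t → t < R₁ → 0 < C₁ * t ^ α - C₂ * μ * t ^ β - C₃ * t ^ γ) ∧
        C₁ * R₁ ^ α - C₂ * μ * R₁ ^ β - C₃ * R₁ ^ γ = 0 ∧
        (∀ t : ℝ, R₁ < t → C₁ * t ^ α - C₂ * μ * t ^ β - C₃ * t ^ γ < 0) ∧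
        (∃ tmax : ℝ, 0 < tmax ∧
          0 < C₁ * tmax ^ α - C₂ * μ * tmax ^ β - C₃ * tmax ^ γ ∧
          ∀ t : ℝ, 0 < t →
            C₁ * t ^ α - C₂ * μ * t ^ β - C₃ * t ^ γ ≤
              C₁ * tmax ^ α - C₂ * μ * tmax ^ β - C₃ * tmax ^ γ) := by
  have hd : 0 < α - β := sub_pos.2 hβα
  obtain ⟨m, hm, H⟩ := exists_two_zeros_mul_sub_mul_rpow hC₁ hC₃
    (by rw [one_lt_div hd]; linarith : 1 < (γ - β) / (α - β))
  refine ⟨m / C₂, by positivity, fun μ hμ hμm => ?_⟩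
  obtain ⟨a, b, ha, hab, hfa, hfb, hlt, hmid, hgt⟩ :=
    H (C₂ * μ) (by positivity) (by rwa [lt_div_iff₀' hC₂] at hμm)
  have hb : 0 < b := ha.trans hab
  have hfac : ∀ t : ℝ, 0 < t → C₁ * t ^ α - C₂ * μ * t ^ β - C₃ * t ^ γ = t ^ β *
      (C₁ * t ^ (α - β) - C₃ * (t ^ (α - β)) ^ ((γ - β) / (α - β)) - C₂ * μ) := by
    intro t ht
    rw [← Real.rpow_mul ht.le, mul_div_cancel₀ _ hd.ne', Real.rpow_sub ht, Real.rpow_sub ht]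
    have := Real.rpow_pos_of_pos ht β
    field_simp
    ring
  have hroot : ∀ x : ℝ, 0 < x → (x ^ (α - β)⁻¹) ^ (α - β) = x := fun x hx =>
    Real.rpow_inv_rpow hx.le hd.ne'
  have hR₀ : 0 < a ^ (α - β)⁻¹ := by positivity
  have hR₁ : 0 < b ^ (α - β)⁻¹ := by positivity
  have hR : a ^ (α - β)⁻¹ < b ^ (α - β)⁻¹ := Real.rpow_lt_rpow ha.le hab (by positivity)
  set R₀ := a ^ (α - β)⁻¹
  set R₁ := b ^ (α - β)⁻¹
  have h₁ : ∀ t : ℝ, 0 < t → t < R₀ → C₁ * t ^ α - C₂ * μ * t ^ β - C₃ * t ^ γ < 0 := by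
    intro t ht htR
    rw [hfac t ht]
    refine mul_neg_of_pos_of_neg (by positivity) (hlt _ (by positivity) ?_)
    simpa [R₀, hroot a ha] using Real.rpow_lt_rpow ht.le htR hd
  have h₂ : ∀ t : ℝ, R₀ < t → t < R₁ → 0 < C₁ * t ^ α - C₂ * μ * t ^ β - C₃ * t ^ γ := by
    intro t hRt htR
    have ht : 0 < t := hR₀.trans hRt
    rw [hfac t ht]
    refine mul_pos (by positivity) (hmid _ ?_ ?_)
    · simpa [R₀, hroot a ha] using Real.rpow_lt_rpow hR₀.le hRt hd
    · simpa [R₁, hroot b hb] using Real.rpow_lt_rpow ht.le htR hd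
  have h₃ : ∀ t : ℝ, R₁ < t → C₁ * t ^ α - C₂ * μ * t ^ β - C₃ * t ^ γ < 0 := by
    intro t hRt
    have ht : 0 < t := hR₁.trans hRt
    rw [hfac t ht]
    refine mul_neg_of_pos_of_neg (by positivity) (hgt _ ?_)
    simpa [R₁, hroot b hb] using Real.rpow_lt_rpow hR₁.le hRt hd
  refine ⟨R₀, R₁, hR₀, hR, h₁, by rw [hfac R₀ hR₀, hroot a ha, hfa, mul_zero], h₂,
    by rw [hfac R₁ hR₁, hroot b hb, hfb, mul_zero], h₃, ?_⟩
  have hcont : Continuous fun t : ℝ => C₁ * t ^ α - C₂ * μ * t ^ β - C₃ * t ^ γ := by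
    have hα := Real.continuous_rpow_const (q := α) (by linarith)
    have hβ' := Real.continuous_rpow_const (q := β) (by linarith)
    have hγ := Real.continuous_rpow_const (q := γ) (by linarith)
    fun_prop
  obtain ⟨x, hx, hmax⟩ := isCompact_Icc.exists_isMaxOn (Set.nonempty_Icc.2 hR.le)
    hcont.continuousOn
  have hpos : 0 < C₁ * x ^ α - C₂ * μ * x ^ β - C₃ * x ^ γ :=
    (h₂ ((R₀ + R₁) / 2) (by linarith) (by linarith)).trans_le
      (hmax (⟨by linarith, by linarith⟩ : (R₀ + R₁) / 2 ∈ Set.Icc R₀ R₁))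
  refine ⟨x, hR₀.trans_le hx.1, hpos, fun t ht => ?_⟩
  rcases lt_or_ge t R₀ with htR | hRt
  · exact ((h₁ t ht htR).trans hpos).le
  rcases lt_or_ge R₁ t with hRt' | htR
  · exact ((h₃ t hRt').trans hpos).le
  · exact hmax (⟨hRt, htR⟩ : t ∈ Set.Icc R₀ R₁)
end
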